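/- arXiv:1611.05256 — 3 statements merged into one kernel-verified Lean document; each statement's English description precedes it below -/
import Mathlib

section
/- For all integers n, k with 0 ≤ k ≤ n, ∑_{j=0}^{k} [n−j choose k−j]_q [n−k+j−1 choose j]_q q^{(n−k+1)j} = [2n−k choose k]_q and ∑_{j=0}^{k} [n−j choose k−j]_q [n−k+j choose j]_q q^{(n−k+1)j} = [2n+1−k choose k]_q in ℚ(q). Consequently the generalized q-Fibonacci polynomial at t = 1 equals the q-Fibonacci polynomial: F_n(x,1,q) = F_n(x,q). -/
open Finset Polynomial

/-- The field `ℚ(q)` of rational functions. -/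
noncomputable abbrev K : Type := RatFunc ℚ

/-- The indeterminate `q`, viewed in `ℚ(q)`. -/
noncomputable def q : K := RatFunc.X

/-- The Gaussian binomial coefficient `[n choose k]_q` in `ℚ(q)`; it is `0` for `k < 0`
or `k > n`, with the convention `[m choose 0]_q = 1` for every integer `m`. -/
noncomputable def qbinom (n k : ℤ) : K :=
  if 0 ≤ k ∧ k ≤ n then
    ∏ i ∈ Finset.range k.toNat, (1 - q ^ (n - k + (i : ℤ) + 1)) / (1 - q ^ ((i : ℤ) + 1))
  else if k = 0 then 1 else 0

/-- The q-Fibonacci polynomial `F_n(x,q) ∈ ℚ(q)[x]`. -/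
noncomputable def qFib (n : ℕ) : Polynomial K :=
  ∑ j ∈ Finset.range (n / 2 + 1),
    Polynomial.C ((-1 : K) ^ j * q ^ (j * (j - 1) / 2) * qbinom ((n : ℤ) - j) j) *
      Polynomial.X ^ (n - 2 * j)

/-- The generalized q-Fibonacci polynomials `F_n(x,t,q)`, viewed as elements of
`ℚ(q)[t][x]` (the outer variable is `x`, the inner one is `t`). -/
noncomputable def genF (n : ℕ) : Polynomial (Polynomial K) :=
  if n % 2 = 0 then
    ∑ k ∈ Finset.range (n / 2 + 1),
      Polynomial.C (((-1 : K) ^ k * q ^ (k * (k - 1) / 2)) •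
        ∑ j ∈ Finset.range (k + 1),
          Polynomial.C (qbinom ((n / 2 : ℕ) - (j : ℤ)) ((k : ℤ) - j) *
              qbinom ((n / 2 : ℕ) - (k : ℤ) + j - 1) j * q ^ ((n / 2 - k + 1) * j)) *
            Polynomial.X ^ j) *
        Polynomial.X ^ (2 * (n / 2) - 2 * k)
  else
    ∑ k ∈ Finset.range (n / 2 + 1),
      Polynomial.C (((-1 : K) ^ k * q ^ (k * (k - 1) / 2)) •
        ∑ j ∈ Finset.range (k + 1),
          Polynomial.C (qbinom ((n / 2 : ℕ) - (j : ℤ)) ((k : ℤ) - j) *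
              qbinom ((n / 2 : ℕ) - (k : ℤ) + j) j * q ^ ((n / 2 - k + 1) * j)) *
            Polynomial.X ^ j) *
        Polynomial.X ^ (2 * (n / 2) + 1 - 2 * k)

theorem one_sub_q_pow_succ_ne_zero (k : ℕ) : (1 : K) - q ^ (k + 1) ≠ 0 := by
  intro h
  have hX : (RatFunc.X : K) ^ (k + 1) = 1 := (sub_eq_zero.mp h).symm
  have hP : (Polynomial.X : ℚ[X]) ^ (k + 1) = 1 := by
    apply RatFunc.algebraMap_injective ℚ
    simpa using hX
  simpa using congrArg Polynomial.natDegree hP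

/-- The rising Gaussian coefficient `[a + k - 1 choose k]_q`, the complete homogeneous
symmetric polynomial of degree `k` in `1, q, …, q ^ (a - 1)`. -/
noncomputable def qmultichoose (a k : ℕ) : K :=
  ∏ i ∈ Finset.range k, (1 - q ^ (a + i)) / (1 - q ^ (i + 1))

theorem qmultichoose_zero_right (a : ℕ) : qmultichoose a 0 = 1 := by
  simp [qmultichoose]

theorem qmultichoose_zero_succ (k : ℕ) : qmultichoose 0 (k + 1) = 0 := by
  simp [qmultichoose, Finset.prod_range_succ']

theorem qmultichoose_succ_right_mul (a k : ℕ) :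
    qmultichoose a (k + 1) * (1 - q ^ (k + 1)) = qmultichoose a k * (1 - q ^ (a + k)) := by
  rw [qmultichoose, Finset.prod_range_succ, mul_assoc,
    div_mul_cancel₀ _ (one_sub_q_pow_succ_ne_zero k), qmultichoose]

theorem qmultichoose_succ_left_mul (a k : ℕ) :
    qmultichoose (a + 1) k * (1 - q ^ a) = qmultichoose a k * (1 - q ^ (a + k)) := by
  induction k with
  | zero => simp [qmultichoose_zero_right]
  | succ k ih =>
    apply mul_right_cancel₀ (one_sub_q_pow_succ_ne_zero k)
    have h₁ := qmultichoose_succ_right_mul a k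
    have h₂ := qmultichoose_succ_right_mul (a + 1) k
    have e : a + 1 + k = a + (k + 1) := by ring
    rw [e] at h₂
    linear_combination (1 - q ^ a) * h₂ + (1 - q ^ (a + (k + 1))) * (ih - h₁)

theorem qmultichoose_succ_succ (a k : ℕ) :
    qmultichoose (a + 1) (k + 1) = qmultichoose a (k + 1) + q ^ a * qmultichoose (a + 1) k := by
  apply mul_right_cancel₀ (one_sub_q_pow_succ_ne_zero k)
  linear_combination qmultichoose_succ_right_mul (a + 1) k - qmultichoose_succ_right_mul a k
    + qmultichoose_succ_left_mul a k

/-- The q-Vandermonde convolution. -/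
theorem sum_qmultichoose_mul (a b k : ℕ) :
    ∑ j ∈ Finset.range (k + 1), qmultichoose a (k - j) * qmultichoose b j * q ^ (a * j) =
      qmultichoose (a + b) k := by
  induction b generalizing k with
  | zero =>
    rw [Finset.sum_range_succ']
    simp [qmultichoose_zero_succ, qmultichoose_zero_right]
  | succ b ihb =>
    induction k with
    | zero => simp [qmultichoose_zero_right]
    | succ k ihk =>
      have hb := ihb (k + 1)
      rw [Finset.sum_range_succ'] at hb ⊢
      rw [← add_assoc, qmultichoose_succ_succ, ← hb, add_assoc a b 1, ← ihk, Finset.mul_sum,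
        add_right_comm, ← Finset.sum_add_distrib]
      simp only [qmultichoose_zero_right]
      congr 1
      refine Finset.sum_congr rfl fun j _ => ?_
      rw [qmultichoose_succ_succ, Nat.add_sub_add_right]
      ring

theorem qbinom_eq_qmultichoose {n : ℤ} {k' : ℤ} (a k : ℕ) (hk : k' = k) (hn : n = a + k - 1) :
    qbinom n k' = qmultichoose a k := by
  subst hk hn
  rcases k with _ | k
  · simp [qbinom, qmultichoose]
  rcases a with _ | a
  · rw [qmultichoose_zero_succ, qbinom, if_neg (by push_cast; omega),
      if_neg (by push_cast; omega)]
  rw [qbinom, if_pos (by push_cast; omega), qmultichoose, Int.toNat_natCast]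
  refine Finset.prod_congr rfl fun i _ => ?_
  have e₁ : ((a + 1 : ℕ) + (k + 1 : ℕ) - 1 - (k + 1 : ℕ) + i + 1 : ℤ) = (a + 1 + i : ℕ) := by
    push_cast; ring
  have e₂ : (i + 1 : ℤ) = (i + 1 : ℕ) := by push_cast; ring
  rw [e₁, e₂, zpow_natCast, zpow_natCast]

theorem sum_qbinom_even {n k : ℕ} (h : k ≤ n) :
    ∑ j ∈ Finset.range (k + 1),
      qbinom ((n : ℤ) - j) ((k : ℤ) - j) * qbinom ((n : ℤ) - k + j - 1) j *
        q ^ ((n - k + 1) * j) = qbinom (2 * n - (k : ℤ)) k := by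
  obtain ⟨m, rfl⟩ := Nat.exists_eq_add_of_le' h
  rw [qbinom_eq_qmultichoose (m + 1 + m) k rfl (by push_cast; ring), ← sum_qmultichoose_mul]
  refine Finset.sum_congr rfl fun j hj => ?_
  have hj : j ≤ k := Finset.mem_range_succ_iff.mp hj
  rw [qbinom_eq_qmultichoose (m + 1) (k - j) (by omega) (by omega),
    qbinom_eq_qmultichoose m j rfl (by omega), Nat.add_sub_cancel]

theorem sum_qbinom_odd {n k : ℕ} (h : k ≤ n) :
    ∑ j ∈ Finset.range (k + 1),
      qbinom ((n : ℤ) - j) ((k : ℤ) - j) * qbinom ((n : ℤ) - k + j) j *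
        q ^ ((n - k + 1) * j) = qbinom (2 * n + 1 - (k : ℤ)) k := by
  obtain ⟨m, rfl⟩ := Nat.exists_eq_add_of_le' h
  rw [qbinom_eq_qmultichoose (m + 1 + (m + 1)) k rfl (by push_cast; ring),
    ← sum_qmultichoose_mul]
  refine Finset.sum_congr rfl fun j hj => ?_
  have hj : j ≤ k := Finset.mem_range_succ_iff.mp hj
  rw [qbinom_eq_qmultichoose (m + 1) (k - j) (by omega) (by omega),
    qbinom_eq_qmultichoose (m + 1) j rfl (by omega), Nat.add_sub_cancel]

theorem map_evalRingHom_one_term (c : K) (f : ℕ → K) (k e : ℕ) :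
    (Polynomial.C (c • ∑ j ∈ Finset.range (k + 1), Polynomial.C (f j) * Polynomial.X ^ j) *
        Polynomial.X ^ e : Polynomial (Polynomial K)).map (Polynomial.evalRingHom (1 : K)) =
      Polynomial.C (c * ∑ j ∈ Finset.range (k + 1), f j) * Polynomial.X ^ e := by
  simp [Polynomial.eval_finsetSum]

theorem map_genF (n : ℕ) : (genF n).map (Polynomial.evalRingHom (1 : K)) = qFib n := by
  unfold genF qFib
  split_ifs with hn
  all_goals
    rw [Polynomial.map_sum]
    refine Finset.sum_congr rfl fun k hk => ?_
    have hk : k ≤ n / 2 := Finset.mem_range_succ_iff.mp hk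
    rw [map_evalRingHom_one_term]
  · rw [sum_qbinom_even hk, show (2 * (n / 2 : ℕ) : ℤ) = n by omega,
      show 2 * (n / 2) = n by omega]
  · rw [sum_qbinom_odd hk, show (2 * (n / 2 : ℕ) + 1 : ℤ) = n by omega,
      show 2 * (n / 2) + 1 = n by omega]

/-- The two q-Vandermonde evaluations of the inner sums of the generalized q-Fibonacci
polynomials, and the consequence `F_n(x,1,q) = F_n(x,q)`. -/
theorem genF_at_one :
    (∀ n k : ℕ, k ≤ n →
      ∑ j ∈ Finset.range (k + 1),
        qbinom ((n : ℤ) - j) ((k : ℤ) - j) * qbinom ((n : ℤ) - k + j - 1) j *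
          q ^ ((n - k + 1) * j) = qbinom (2 * n - (k : ℤ)) k) ∧
    (∀ n k : ℕ, k ≤ n →
      ∑ j ∈ Finset.range (k + 1),
        qbinom ((n : ℤ) - j) ((k : ℤ) - j) * qbinom ((n : ℤ) - k + j) j *
          q ^ ((n - k + 1) * j) = qbinom (2 * n + 1 - (k : ℤ)) k) ∧
    (∀ n : ℕ, (genF n).map (Polynomial.evalRingHom (1 : K)) = qFib n) := by
  exact ⟨fun _ _ => sum_qbinom_even, fun _ _ => sum_qbinom_odd, map_genF⟩
end

section
/- The coefficients a(n,k,t,q) satisfy, for all n ≥ 1 and k ≥ 0: a(2n,2k,t,q) = a(2n−1,2k−1,qt,q) + q^k a(2n−1,2k+1,qt,q) and a(2n+1,2k+1,t,q) = a(2n,2k,qt,q) + q^{k+1} t · a(2n,2k+2,qt,q), where a(m,j,qt,q) denotes the result of substituting qt for t. -/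
open Finset Polynomial

/-- The connection coefficients `a(m, j, t, q) ∈ ℚ(q)[t]`:
`a(2n, 2k, t, q) = q^{−(n−k)} ∑_{i=0}^{n−k} q^{i²+(k+1)i}
  ([n−1 choose i][n+1 choose i+k+1] − [n choose i][n choose i+k+1]) t^i`,
`a(2n+1, 2k+1, t, q) = q^{−(n−k)} ∑_{i=0}^{n−k} q^{i²+(k+1)i}
  ([n choose i][n+1 choose i+k+1] − [n+1 choose i][n choose i+k+1]) t^i`,
and `a(m, j, t, q) = 0` whenever `m − j` is odd or `j < 0` or `j > m`. -/
noncomputable def coeffA (m j : ℤ) : Polynomial K :=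
  if 0 ≤ j ∧ j ≤ m ∧ (m - j) % 2 = 0 then
    if m % 2 = 0 then
      q ^ (-(m / 2 - j / 2)) •
        ∑ i ∈ Finset.range ((m / 2 - j / 2).toNat + 1),
          Polynomial.C (q ^ ((i : ℤ) ^ 2 + (j / 2 + 1) * i) *
            (qbinom (m / 2 - 1) i * qbinom (m / 2 + 1) ((i : ℤ) + j / 2 + 1) -
             qbinom (m / 2) i * qbinom (m / 2) ((i : ℤ) + j / 2 + 1))) * Polynomial.X ^ i
    else
      q ^ (-(m / 2 - j / 2)) •
        ∑ i ∈ Finset.range ((m / 2 - j / 2).toNat + 1),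
          Polynomial.C (q ^ ((i : ℤ) ^ 2 + (j / 2 + 1) * i) *
            (qbinom (m / 2) i * qbinom (m / 2 + 1) ((i : ℤ) + j / 2 + 1) -
             qbinom (m / 2 + 1) i * qbinom (m / 2) ((i : ℤ) + j / 2 + 1))) * Polynomial.X ^ i
  else 0

/-- The ring homomorphism `ℚ(q)[t] → ℚ(q)[t]` substituting `qt` for `t`. -/
noncomputable def substQt : Polynomial K →+* Polynomial K :=
  (Polynomial.aeval (Polynomial.C q * Polynomial.X : Polynomial K)).toRingHom

theorem q_ne_zero : q ≠ 0 := RatFunc.X_ne_zero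

theorem one_sub_q_zpow_ne_zero (i : ℕ) : (1 : K) - q ^ ((i : ℤ) + 1) ≠ 0 := by
  intro h
  have h1 : (RatFunc.X : RatFunc ℚ) ^ (i + 1) = 1 := by
    have h2 := (sub_eq_zero.mp h).symm
    rw [q] at h2
    exact_mod_cast h2
  rw [← RatFunc.algebraMap_X, ← map_pow,
    ← map_one (algebraMap ℚ[X] (RatFunc ℚ))] at h1
  have h3 := congrArg Polynomial.natDegree (RatFunc.algebraMap_injective ℚ h1)
  simp at h3

/-- For natural `k` the product formula for the Gaussian binomial also covers `k > n`. -/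
theorem qbinom_natCast (n : ℤ) (hn : 0 ≤ n) (k : ℕ) :
    qbinom n k = (∏ i ∈ range k, (1 - q ^ (n - k + (i : ℤ) + 1))) /
      ∏ i ∈ range k, (1 - q ^ ((i : ℤ) + 1)) := by
  unfold qbinom
  split_ifs with h h0
  · rw [Int.toNat_natCast, prod_div_distrib]
  · omega
  · rw [prod_eq_zero (i := (k - n - 1).toNat), zero_div]
    · rw [mem_range]
      omega
    · have : n - k + ((k - n - 1).toNat : ℤ) + 1 = 0 := by omega
      rw [this, zpow_zero, sub_self]

theorem qbinom_of_neg {n k : ℤ} (hk : k < 0) : qbinom n k = 0 := by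
  unfold qbinom
  rw [if_neg (by omega), if_neg (by omega)]

theorem qbinom_of_lt {n k : ℤ} (hn : 0 ≤ n) (hk : n < k) : qbinom n k = 0 := by
  unfold qbinom
  rw [if_neg (by omega), if_neg (by omega)]

theorem qbinom_zero_right (n : ℤ) : qbinom n 0 = 1 := by
  simp [qbinom]

/-- The `q`-Pascal rule. -/
theorem qbinom_add_one (n : ℤ) (hn : 0 ≤ n) (k : ℤ) :
    qbinom (n + 1) k = qbinom n (k - 1) + q ^ k * qbinom n k := by
  rcases lt_trichotomy k 0 with hk | rfl | hk
  · rw [qbinom_of_neg hk, qbinom_of_neg hk, qbinom_of_neg (by omega)]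
    simp
  · rw [qbinom_zero_right, qbinom_zero_right, qbinom_of_neg (by omega)]
    simp
  · obtain ⟨p, rfl⟩ : ∃ p : ℕ, k = ((p + 1 : ℕ) : ℤ) := ⟨(k - 1).toNat, by omega⟩
    have hp : ((p + 1 : ℕ) : ℤ) - 1 = p := by push_cast; ring
    rw [hp, qbinom_natCast _ (by omega), qbinom_natCast _ hn, qbinom_natCast _ hn]
    have hupper : ∏ i ∈ range (p + 1), (1 - q ^ (n + 1 - ((p + 1 : ℕ) : ℤ) + (i : ℤ) + 1)) =
        (∏ i ∈ range p, (1 - q ^ (n - p + (i : ℤ) + 1))) * (1 - q ^ (n + 1)) := by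
      rw [prod_range_succ]
      push_cast
      ring_nf
    have hlower : ∏ i ∈ range (p + 1), (1 - q ^ (n - ((p + 1 : ℕ) : ℤ) + (i : ℤ) + 1)) =
        (∏ i ∈ range p, (1 - q ^ (n - p + (i : ℤ) + 1))) * (1 - q ^ (n - p)) := by
      rw [prod_range_succ']
      push_cast
      ring_nf
    rw [hupper, hlower, prod_range_succ (fun i : ℕ => (1 : K) - q ^ ((i : ℤ) + 1))]
    have hden : ∏ i ∈ range p, ((1 : K) - q ^ ((i : ℤ) + 1)) ≠ 0 :=
      prod_ne_zero_iff.mpr fun i _ => one_sub_q_zpow_ne_zero i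
    have hlast := one_sub_q_zpow_ne_zero p
    have hpow : q ^ (n + 1) = q ^ ((p : ℤ) + 1) * q ^ (n - p) := by
      rw [← zpow_add₀ q_ne_zero]
      ring_nf
    rw [hpow, show ((p + 1 : ℕ) : ℤ) = (p : ℤ) + 1 by push_cast; rfl]
    generalize q ^ ((p : ℤ) + 1) = x at *
    generalize q ^ (n - p) = y at *
    field_simp
    ring

theorem coeff_sum_C_mul_X_pow (f : ℕ → K) (N i : ℕ) (hf : ∀ j, N ≤ j → f j = 0) :
    (∑ j ∈ range N, C (f j) * X ^ j).coeff i = f i := by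
  rw [finsetSum_coeff]
  simp only [coeff_C_mul_X_pow, sum_ite_eq, mem_range]
  split_ifs with h
  · rfl
  · exact (hf i (by omega)).symm

theorem coeff_coeffA_even (n k : ℤ) (hn : 1 ≤ n) (hk : 0 ≤ k) (i : ℕ) :
    (coeffA (2 * n) (2 * k)).coeff i = q ^ (-(n - k)) * (q ^ ((i : ℤ) ^ 2 + (k + 1) * i) *
      (qbinom (n - 1) i * qbinom (n + 1) ((i : ℤ) + k + 1) -
        qbinom n i * qbinom n ((i : ℤ) + k + 1))) := by
  have hvanish : ∀ j : ℕ, n - k < j → q ^ ((j : ℤ) ^ 2 + (k + 1) * j) *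
      (qbinom (n - 1) j * qbinom (n + 1) ((j : ℤ) + k + 1) -
        qbinom n j * qbinom n ((j : ℤ) + k + 1)) = 0 := by
    intro j hj
    rw [qbinom_of_lt (n := n + 1) (by omega) (by omega),
      qbinom_of_lt (n := n) (k := j + k + 1) (by omega) (by omega)]
    simp
  unfold coeffA
  rw [show 2 * n / 2 = n by omega, show 2 * k / 2 = k by omega]
  split_ifs with h h'
  · rw [coeff_smul, coeff_sum_C_mul_X_pow _ _ _ fun j hj => hvanish j (by omega), smul_eq_mul]
  · omega
  · rw [hvanish i (by omega)]
    simp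

theorem coeff_coeffA_odd (n k : ℤ) (hn : 0 ≤ n) (hk : -1 ≤ k) (i : ℕ) :
    (coeffA (2 * n + 1) (2 * k + 1)).coeff i =
      q ^ (-(n - k)) * (q ^ ((i : ℤ) ^ 2 + (k + 1) * i) *
        (qbinom n i * qbinom (n + 1) ((i : ℤ) + k + 1) -
          qbinom (n + 1) i * qbinom n ((i : ℤ) + k + 1))) := by
  have hvanish : ∀ j : ℕ, n - k < j → q ^ ((j : ℤ) ^ 2 + (k + 1) * j) *
      (qbinom n j * qbinom (n + 1) ((j : ℤ) + k + 1) -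
        qbinom (n + 1) j * qbinom n ((j : ℤ) + k + 1)) = 0 := by
    intro j hj
    rw [qbinom_of_lt (n := n + 1) (k := j + k + 1) (by omega) (by omega),
      qbinom_of_lt (n := n) (k := j + k + 1) (by omega) (by omega)]
    simp
  unfold coeffA
  rw [show (2 * n + 1) / 2 = n by omega, show (2 * k + 1) / 2 = k by omega]
  split_ifs with h h'
  · omega
  · rw [coeff_smul, coeff_sum_C_mul_X_pow _ _ _ fun j hj => hvanish j (by omega), smul_eq_mul]
  · rcases eq_or_lt_of_le hk with rfl | hk'
    · rw [show (i : ℤ) + -1 + 1 = i by ring, mul_comm (qbinom n i), sub_self]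
      simp
    · rw [hvanish i (by omega)]
      simp

theorem coeff_substQt (p : Polynomial K) (i : ℕ) :
    (substQt p).coeff i = q ^ (i : ℤ) * p.coeff i := by
  have : substQt p = p.comp (C q * X) := rfl
  rw [this, comp_C_mul_X_coeff, zpow_natCast, mul_comm]

/-- The recurrences `a(2n,2k,t,q) = a(2n−1,2k−1,qt,q) + q^k a(2n−1,2k+1,qt,q)` and
`a(2n+1,2k+1,t,q) = a(2n,2k,qt,q) + q^{k+1} t a(2n,2k+2,qt,q)` for `n ≥ 1`, `k ≥ 0`. -/
theorem coeffA_recurrence (n k : ℤ) (hn : 1 ≤ n) (hk : 0 ≤ k) :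
    coeffA (2 * n) (2 * k) =
      substQt (coeffA (2 * n - 1) (2 * k - 1)) + q ^ k • substQt (coeffA (2 * n - 1) (2 * k + 1)) ∧
    coeffA (2 * n + 1) (2 * k + 1) =
      substQt (coeffA (2 * n) (2 * k)) +
        Polynomial.C (q ^ (k + 1)) * Polynomial.X * substQt (coeffA (2 * n) (2 * k + 2)) := by
  constructor
  · ext i
    rw [show 2 * n - 1 = 2 * (n - 1) + 1 by ring, show 2 * k - 1 = 2 * (k - 1) + 1 by ring,
      coeff_add, coeff_smul, coeff_substQt, coeff_substQt, coeff_coeffA_even n k hn hk,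
      coeff_coeffA_odd _ _ (by omega) (by omega), coeff_coeffA_odd _ _ (by omega) (by omega),
      smul_eq_mul, qbinom_add_one n (by omega) (i + k + 1)]
    have hpascal := qbinom_add_one (n - 1) (by omega) (i + k + 1)
    rw [show (i : ℤ) + k + 1 - 1 = i + k by ring, sub_add_cancel] at hpascal
    rw [show (i : ℤ) + k + 1 - 1 = i + k by ring, show (i : ℤ) + (k - 1) + 1 = i + k by ring,
      sub_add_cancel, sub_add_cancel, show n - 1 - (k - 1) = n - k by ring]
    have hpow : q ^ (i : ℤ) * q ^ ((i : ℤ) ^ 2 + k * i) = q ^ ((i : ℤ) ^ 2 + (k + 1) * i) := by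
      rw [← zpow_add₀ q_ne_zero]
      ring_nf
    have hpow' : q ^ k * q ^ (i : ℤ) * q ^ (-(n - 1 - k)) =
        q ^ (-(n - k)) * q ^ ((i : ℤ) + k + 1) := by
      simp only [← zpow_add₀ q_ne_zero]
      ring_nf
    linear_combination
      (-q ^ (-(n - k)) * q ^ ((i : ℤ) ^ 2 + (k + 1) * i) * qbinom n i) * hpascal -
      (q ^ (-(n - k)) * (qbinom (n - 1) i * qbinom n (i + k) -
        qbinom n i * qbinom (n - 1) (i + k))) * hpow -
      (q ^ ((i : ℤ) ^ 2 + (k + 1) * i) * (qbinom (n - 1) i * qbinom n (i + k + 1) -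
        qbinom n i * qbinom (n - 1) (i + k + 1))) * hpow'
  · ext i
    rw [show 2 * k + 2 = 2 * (k + 1) by ring, coeff_add, coeff_substQt,
      coeff_coeffA_even n k hn hk, coeff_coeffA_odd _ _ (by omega) (by omega),
      mul_assoc, coeff_C_mul]
    have hpascal := qbinom_add_one (n - 1) (by omega) i
    rw [sub_add_cancel] at hpascal
    rw [qbinom_add_one n (by omega) i]
    rcases i with _ | i
    · rw [coeff_X_mul_zero]
      simp [qbinom_zero_right, qbinom_of_neg]
    · rw [coeff_X_mul, coeff_substQt, coeff_coeffA_even n (k + 1) hn (by omega)]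
      have hcast : ((i + 1 : ℕ) : ℤ) - 1 = i := by push_cast; ring
      rw [hcast] at hpascal ⊢
      rw [show (i : ℤ) + (k + 1) + 1 = ((i + 1 : ℕ) : ℤ) + k + 1 by push_cast; ring]
      have hpow : q ^ (k + 1) * q ^ (i : ℤ) * q ^ (-(n - (k + 1))) *
          q ^ ((i : ℤ) ^ 2 + (k + 1 + 1) * i) =
          q ^ (-(n - k)) * q ^ (((i + 1 : ℕ) : ℤ) ^ 2 + (k + 1) * ((i + 1 : ℕ) : ℤ)) := by
        simp only [← zpow_add₀ q_ne_zero]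
        push_cast
        ring_nf
      linear_combination
        (q ^ (-(n - k)) * q ^ (((i + 1 : ℕ) : ℤ) ^ 2 + (k + 1) * ((i + 1 : ℕ) : ℤ)) *
          qbinom (n + 1) (((i + 1 : ℕ) : ℤ) + k + 1)) * hpascal -
        (qbinom (n - 1) i * qbinom (n + 1) (((i + 1 : ℕ) : ℤ) + k + 1) -
          qbinom n i * qbinom n (((i + 1 : ℕ) : ℤ) + k + 1)) * hpow
end

section
/- For all integers n, k with 0 ≤ k ≤ n, the identity q^{−(n−k)} ∑_{j=0}^{n−k} q^{j²+j+kj} ([n choose j]_q [n+1 choose k+j+1]_q − [n+1 choose j]_q [n choose k+j+1]_q) t^j = ([k+1]/[n+1]) ∑_{j=0}^{n−k} q^{j²+kj} [n+1 choose j]_q [n+1 choose k+j+1]_q t^j holds in ℚ(q)[t]. -/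
open Finset Polynomial

/-- `[n] = (1 - q^n)/(1 - q)` in `ℚ(q)`. -/
noncomputable def qint (n : ℕ) : K := (1 - q ^ n) / (1 - q)

theorem one_sub_q_pow_ne_zero {m : ℕ} (hm : m ≠ 0) : (1 : K) - q ^ m ≠ 0 := by
  intro h
  have hpow : algebraMap ℚ[X] K (X ^ m) = algebraMap ℚ[X] K 1 := by
    rw [map_pow, RatFunc.algebraMap_X, map_one]
    exact (sub_eq_zero.mp h).symm
  have hdeg := congrArg natDegree (RatFunc.algebraMap_injective ℚ hpow)
  rw [natDegree_X_pow, natDegree_one] at hdeg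
  exact hm hdeg

theorem qbinom_add_right (d j : ℕ) :
    qbinom ((d : ℤ) + j) j =
      (∏ i ∈ range j, (1 - q ^ (d + i + 1))) / ∏ i ∈ range j, (1 - q ^ (i + 1)) := by
  rw [qbinom, if_pos (by omega), Int.toNat_natCast, ← prod_div_distrib]
  refine prod_congr rfl fun i _ => ?_
  rw [add_sub_cancel_right]
  norm_cast

/-- The absorption identity relating rows `n` and `n + 1` of the Gaussian binomials. -/
theorem one_sub_q_pow_mul_qbinom {n j d : ℕ} (h : d + j = n + 1) :
    (1 - q ^ (n + 1)) * qbinom n j = (1 - q ^ d) * qbinom ((n : ℤ) + 1) j := by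
  cases d with
  | zero =>
    rw [qbinom, if_neg (by omega), if_neg (by omega)]
    simp
  | succ d =>
    obtain rfl : n = d + j := by omega
    have h₁ := qbinom_add_right d j
    have h₂ := qbinom_add_right (d + 1) j
    have h₃ := prod_range_succ (fun i => (1 : K) - q ^ (d + i + 1)) j
    rw [prod_range_succ'] at h₃
    have e : ((d + j : ℕ) : ℤ) + 1 = ((d + 1 : ℕ) : ℤ) + j := by push_cast; ring
    have h₄ : ∏ i ∈ range j, ((1 : K) - q ^ (d + 1 + i + 1)) =
        ∏ i ∈ range j, (1 - q ^ (d + (i + 1) + 1)) :=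
      prod_congr rfl fun i _ => by rw [add_right_comm d 1 i, add_assoc d i 1]
    rw [e, h₂, Nat.cast_add, h₁, h₄, mul_div_assoc', mul_div_assoc', mul_comm, ← h₃, add_zero,
      mul_comm]

/-- The two expressions for `B_{n,k}(t,q)` agree in `ℚ(q)[t]`. -/
theorem coeffB_alt (n k : ℕ) (hkn : k ≤ n) :
    (q ^ (-((n : ℤ) - k))) •
      ∑ j ∈ Finset.range (n - k + 1),
        Polynomial.C (q ^ (j ^ 2 + j + k * j) *
          (qbinom n j * qbinom ((n : ℤ) + 1) ((k : ℤ) + j + 1) -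
           qbinom ((n : ℤ) + 1) j * qbinom n ((k : ℤ) + j + 1))) * Polynomial.X ^ j =
    (qint (k + 1) / qint (n + 1)) •
      ∑ j ∈ Finset.range (n - k + 1),
        Polynomial.C (q ^ (j ^ 2 + k * j) * qbinom ((n : ℤ) + 1) j *
          qbinom ((n : ℤ) + 1) ((k : ℤ) + j + 1)) * Polynomial.X ^ j := by
  rw [smul_sum, smul_sum]
  refine sum_congr rfl fun j hj => ?_
  obtain ⟨d, rfl⟩ : ∃ d, n = k + j + d := ⟨n - k - j, by rw [mem_range] at hj; omega⟩
  rw [← smul_mul_assoc, ← smul_mul_assoc, smul_C, smul_C]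
  congr 2
  have h₁ := one_sub_q_pow_mul_qbinom (n := k + j + d) (j := j) (d := k + d + 1) (by omega)
  have h₂ := one_sub_q_pow_mul_qbinom (n := k + j + d) (j := k + j + 1) (d := d) (by omega)
  have hn := one_sub_q_pow_ne_zero (Nat.add_one_ne_zero (k + j + d))
  have hone : (1 : K) - q ≠ 0 := by simpa using one_sub_q_pow_ne_zero one_ne_zero
  have hq := q_ne_zero
  have hexp : -(((k + j + d : ℕ) : ℤ) - k) = -((j + d : ℕ) : ℤ) := by push_cast; ring
  have hcast : ((k + j + 1 : ℕ) : ℤ) = (k : ℤ) + j + 1 := by push_cast; ring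
  rw [hcast] at h₂
  rw [hexp, zpow_neg, zpow_natCast, qint, qint, div_div_div_cancel_right₀ hone, smul_eq_mul,
    smul_eq_mul, inv_mul_eq_div, div_mul_eq_mul_div, div_eq_div_iff (pow_ne_zero _ hq) hn]
  generalize qbinom ((k + j + d : ℕ) : ℤ) j = a at *
  generalize qbinom ((k + j + d : ℕ) : ℤ) ((k : ℤ) + j + 1) = b at *
  generalize qbinom (((k + j + d : ℕ) : ℤ) + 1) j = A at *
  generalize qbinom (((k + j + d : ℕ) : ℤ) + 1) ((k : ℤ) + j + 1) = B at *
  linear_combination q ^ (j ^ 2 + j + k * j) * (B * h₁ - A * h₂)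
end
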